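/- arXiv:0712.1013 — 9 statements merged into one kernel-verified Lean document; each statement's English description precedes it below -/
import Mathlib

section
/- Let a, b : ℝ → ℝ be three times continuously differentiable with a(0) = 0, let α, β : ℝ → ℝ be continuous functions such that α(x+y)·(a(x) − a(y)) = a'(x) − a'(y) and β(x+y)·(a(x) − a(y)) = b(x) − b(y) for all x, y > 0, and let φ : (0,∞) → ℝ be twice continuously differentiable satisfying φ''(u) + α(u)·φ'(u) − β(u)·φ(u) = 0 for all u > 0. Then for every smooth function f : ℝ → ℝ with compact support contained in (0,∞) and every x > 0, one has L(Γ_φ f)(x) = Γ_φ(L f)(x), i.e. −(d/dx)(a(x)·(d/dx)∫₀^∞ φ(x+y) f(y) dy) + b(x)·∫₀^∞ φ(x+y) f(y) dy = ∫₀^∞ φ(x+y)·( −(a(y) f'(y))' + b(y) f(y) ) dy. -/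
open MeasureTheory Set Filter Topology

lemma continuous_shift_mul {ψ g : ℝ → ℝ} (hψ : ContinuousOn ψ (Ioi 0)) (hg : Continuous g)
    (hgs : tsupport g ⊆ Ioi 0) {x : ℝ} (hx : 0 < x) :
    Continuous fun y => ψ (x + y) * g y := by
  refine continuous_of_tsupport fun y hy => ?_
  have hy0 : 0 < y := hgs (tsupport_mul_subset_right hy)
  have h : ContinuousAt ψ (x + y) := hψ.continuousAt (Ioi_mem_nhds (by positivity))
  exact (ContinuousAt.comp (f := fun y => x + y) h (by fun_prop)).mul hg.continuousAt

lemma integrable_shift_mul {ψ g : ℝ → ℝ} (hψ : ContinuousOn ψ (Ioi 0)) (hg : Continuous g)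
    (hgc : HasCompactSupport g) (hgs : tsupport g ⊆ Ioi 0) {x : ℝ} (hx : 0 < x) :
    Integrable fun y => ψ (x + y) * g y :=
  (continuous_shift_mul hψ hg hgs hx).integrable_of_hasCompactSupport hgc.mul_left

lemma hasDerivAt_hankel {ψ ψ' g : ℝ → ℝ} (hd : ∀ u, 0 < u → HasDerivAt ψ (ψ' u) u)
    (hψ' : ContinuousOn ψ' (Ioi 0)) (hg : Continuous g)
    (hgc : HasCompactSupport g) (hgs : tsupport g ⊆ Ioi 0) {x : ℝ} (hx : 0 < x) :
    HasDerivAt (fun x => ∫ y in Ioi (0 : ℝ), ψ (x + y) * g y)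
      (∫ y in Ioi (0 : ℝ), ψ' (x + y) * g y) x := by
  have hψ : ContinuousOn ψ (Ioi 0) := fun u hu => (hd u hu).continuousAt.continuousWithinAt
  have hpos : ∀ z ∈ Metric.closedBall x (x / 2), 0 < z := by
    intro z hz
    rw [Metric.mem_closedBall, Real.dist_eq, abs_le] at hz
    linarith [hz.1]
  obtain ⟨C, hC⟩ := ((isCompact_closedBall x (x / 2)).prod hgc).exists_bound_of_continuousOn
    (f := fun p : ℝ × ℝ => ψ' (p.1 + p.2)) (hψ'.comp (by fun_prop) fun p hp =>
      add_pos (hpos _ hp.1) (hgs hp.2))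
  refine (hasDerivAt_integral_of_dominated_loc_of_deriv_le
    (F := fun x y => ψ (x + y) * g y) (F' := fun x y => ψ' (x + y) * g y)
    (bound := fun y => C * ‖g y‖) (Metric.closedBall_mem_nhds x (half_pos hx)) ?_ ?_ ?_ ?_ ?_ ?_).2
  · filter_upwards [Ioi_mem_nhds hx] with z hz
    exact (continuous_shift_mul hψ hg hgs hz).aestronglyMeasurable
  · exact (integrable_shift_mul hψ hg hgc hgs hx).integrableOn
  · exact (continuous_shift_mul hψ' hg hgs hx).aestronglyMeasurable
  · refine ae_of_all _ fun y z hz => ?_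
    by_cases hy : y ∈ tsupport g
    · rw [norm_mul]
      exact mul_le_mul_of_nonneg_right (hC (z, y) ⟨hz, hy⟩) (norm_nonneg _)
    · simp [image_eq_zero_of_notMem_tsupport hy]
  · exact ((hg.integrable_of_hasCompactSupport hgc).norm.const_mul C).integrableOn
  · refine (ae_restrict_iff' measurableSet_Ioi).2 (ae_of_all _ fun y hy z hz => ?_)
    exact ((hd (z + y) (add_pos (hpos z hz) hy)).comp_add_const z y).mul_const (g y)

/-- Theorem 2.1: if `α (x+y) (a x - a y) = a' x - a' y` and
`β (x+y) (a x - a y) = b x - b y` for `x, y > 0`, and `φ'' + α φ' - β φ = 0` on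
`(0,∞)`, then the Hankel operator `Γ_φ` with kernel `φ (x+y)` commutes with
`L f = -(a f')' + b f` on smooth functions compactly supported in `(0,∞)`. -/
theorem stmt_0 (a b α β φ : ℝ → ℝ)
    (ha : ContDiff ℝ 3 a) (hb : ContDiff ℝ 3 b) (ha0 : a 0 = 0)
    (hα : Continuous α) (hβ : Continuous β)
    (hαa : ∀ x y : ℝ, 0 < x → 0 < y →
      α (x + y) * (a x - a y) = deriv a x - deriv a y)
    (hβb : ∀ x y : ℝ, 0 < x → 0 < y →
      β (x + y) * (a x - a y) = b x - b y)
    (hφ : ContDiffOn ℝ 2 φ (Set.Ioi 0))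
    (hode : ∀ u : ℝ, 0 < u →
      deriv (deriv φ) u + α u * deriv φ u - β u * φ u = 0)
    (f : ℝ → ℝ) (hf : ContDiff ℝ (⊤ : ℕ∞) f) (hfc : HasCompactSupport f)
    (hfs : tsupport f ⊆ Set.Ioi 0) (x : ℝ) (hx : 0 < x) :
    -(deriv (fun x : ℝ => a x *
        deriv (fun x : ℝ => ∫ y in Set.Ioi (0:ℝ), φ (x + y) * f y) x) x)
      + b x * ∫ y in Set.Ioi (0:ℝ), φ (x + y) * f y
    = ∫ y in Set.Ioi (0:ℝ),
        φ (x + y) * (-(deriv (fun y : ℝ => a y * deriv f y) y) + b y * f y) := by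
  have hφ' : ContDiffOn ℝ 1 (deriv φ) (Ioi 0) :=
    ((contDiffOn_succ_iff_deriv_of_isOpen (n := 1) isOpen_Ioi).1 hφ).2.2
  have hφ'' : ContinuousOn (deriv (deriv φ)) (Ioi 0) :=
    hφ'.continuousOn_deriv_of_isOpen isOpen_Ioi le_rfl
  have d0 : ∀ u, 0 < u → HasDerivAt φ (deriv φ u) u := fun u hu =>
    ((hφ.differentiableOn (by norm_num)).differentiableAt (Ioi_mem_nhds hu)).hasDerivAt
  have d1 : ∀ u, 0 < u → HasDerivAt (deriv φ) (deriv (deriv φ) u) u := fun u hu =>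
    ((hφ'.differentiableOn (by norm_num)).differentiableAt (Ioi_mem_nhds hu)).hasDerivAt
  have hda : ∀ y, HasDerivAt a (deriv a y) y := fun y =>
    (ha.differentiable (by norm_num) y).hasDerivAt
  have hca : Continuous (deriv a) := ha.continuous_deriv (by norm_num)
  have hf' : ContDiff ℝ (⊤ : ℕ∞) (deriv f) := (contDiff_infty_iff_deriv.1 hf).2
  have hf'' : Continuous (deriv (deriv f)) := hf'.continuous_deriv (by norm_num)
  have hdf : ∀ y, HasDerivAt f (deriv f y) y := fun y =>
    (hf.differentiable (by norm_num) y).hasDerivAt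
  have hdf' : ∀ y, HasDerivAt (deriv f) (deriv (deriv f) y) y := fun y =>
    (hf'.differentiable (by norm_num) y).hasDerivAt
  have hs' : tsupport (deriv f) ⊆ Ioi 0 :=
    (closure_minimal support_deriv_subset (isClosed_tsupport f)).trans hfs
  have hs'' : tsupport (deriv (deriv f)) ⊆ Ioi 0 :=
    (closure_minimal support_deriv_subset (isClosed_tsupport _)).trans hs'
  have cf := hf.continuous
  have cf' := hf'.continuous
  have ca := ha.continuous
  have cb := hb.continuous
  have int : ∀ {ψ c g : ℝ → ℝ}, ContinuousOn ψ (Ioi 0) → Continuous c → Continuous g →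
      HasCompactSupport g → tsupport g ⊆ Ioi 0 →
      IntegrableOn (fun y => ψ (x + y) * (c y * g y)) (Ioi 0) := by
    intro ψ c g h1 h2 h3 h4 h5
    exact (integrable_shift_mul h1 (h2.mul h3) h4.mul_left
      (tsupport_mul_subset_right.trans h5) hx).integrableOn
  have i0 := (integrable_shift_mul hφ.continuousOn cf hfc hfs hx).integrableOn (s := Ioi 0)
  have i1 := (integrable_shift_mul hφ'.continuousOn cf hfc hfs hx).integrableOn (s := Ioi 0)
  have i2 := (integrable_shift_mul hφ'' cf hfc hfs hx).integrableOn (s := Ioi 0)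
  have j1 := int hφ.continuousOn hca cf' hfc.deriv hs'
  have j2 := int hφ.continuousOn ca hf'' hfc.deriv.deriv hs''
  have j3 := int hφ.continuousOn cb cf hfc hfs
  have j4 := int hφ'.continuousOn hca cf hfc hfs
  have j5 := int hφ'' ca cf hfc hfs
  have hG : (fun x : ℝ => a x *
        deriv (fun x : ℝ => ∫ y in Set.Ioi (0:ℝ), φ (x + y) * f y) x) =ᶠ[𝓝 x]
      fun x => a x * ∫ y in Ioi (0 : ℝ), deriv φ (x + y) * f y := by
    filter_upwards [Ioi_mem_nhds hx] with z hz
    rw [(hasDerivAt_hankel d0 hφ'.continuousOn cf hfc hfs hz).deriv]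
  rw [hG.deriv_eq, ((hda x).fun_mul (hasDerivAt_hankel d1 hφ'' cf hfc hfs hx)).deriv]
  have hparts : ∫ y in Ioi (0 : ℝ),
      ((φ (x + y) * (deriv a y * deriv f y) + φ (x + y) * (a y * deriv (deriv f) y))
        - (deriv φ (x + y) * (deriv a y * f y) + deriv (deriv φ) (x + y) * (a y * f y))) = 0 := by
    have hH : Continuous fun y =>
        φ (x + y) * (a y * deriv f y) - deriv φ (x + y) * (a y * f y) :=
      (continuous_shift_mul hφ.continuousOn (ca.mul cf')
        (tsupport_mul_subset_right.trans hs') hx).sub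
      (continuous_shift_mul hφ'.continuousOn (ca.mul cf)
        (tsupport_mul_subset_right.trans hfs) hx)
    have hf0 : f 0 = 0 := image_eq_zero_of_notMem_tsupport fun h => lt_irrefl (0 : ℝ) (hfs h)
    have hf0' : deriv f 0 = 0 := image_eq_zero_of_notMem_tsupport fun h => lt_irrefl (0 : ℝ) (hs' h)
    have hlim : Tendsto (fun y => φ (x + y) * (a y * deriv f y) - deriv φ (x + y) * (a y * f y))
        atTop (𝓝 0) := by
      have e : ∀ᶠ y in cocompact ℝ, y ∉ tsupport f := hfc.compl_mem_cocompact
      have e' : ∀ᶠ y in cocompact ℝ, y ∉ tsupport (deriv f) := hfc.deriv.compl_mem_cocompact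
      refine tendsto_const_nhds.congr' ?_
      filter_upwards [atTop_le_cocompact e, atTop_le_cocompact e'] with y h h'
      simp [image_eq_zero_of_notMem_tsupport h, image_eq_zero_of_notMem_tsupport h']
    have := integral_Ioi_of_hasDerivAt_of_tendsto (a := 0) hH.continuousWithinAt
      (fun y hy => ?_) ((j1.add j2).sub (j4.add j5)) hlim
    · refine Eq.trans this ?_
      simp [hf0, hf0']
    · have hxy : 0 < x + y := add_pos hx hy
      refine ((((d0 _ hxy).comp_const_add x y).fun_mul ((hda y).fun_mul (hdf' y))).sub
        (((d1 _ hxy).comp_const_add x y).fun_mul ((hda y).fun_mul (hdf y)))).congr_deriv ?_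
      simp only [Pi.add_apply, Pi.sub_apply]
      ring
  have hderiv : ∀ y, deriv (fun y : ℝ => a y * deriv f y) y
      = deriv a y * deriv f y + a y * deriv (deriv f) y := fun y =>
    ((hda y).fun_mul (hdf' y)).deriv
  simp only [hderiv]
  have hN : IntegrableOn (fun y => -(deriv a x * (deriv φ (x + y) * f y)
      + a x * (deriv (deriv φ) (x + y) * f y))) (Ioi 0) :=
    ((i1.const_mul _).add (i2.const_mul _)).neg
  rw [← sub_eq_zero, ← integral_const_mul, ← integral_const_mul, ← integral_const_mul,
    ← integral_add (i1.const_mul _) (i2.const_mul _), ← integral_neg,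
    ← integral_add hN (i0.const_mul _)]
  have hR : IntegrableOn (fun y => φ (x + y) *
      (-(deriv a y * deriv f y + a y * deriv (deriv f) y) + b y * f y)) (Ioi 0) := by
    refine ((j1.add j2).neg.add j3).congr_fun (fun y _ => ?_) measurableSet_Ioi
    simp only [Pi.add_apply, Pi.neg_apply]
    ring
  refine (integral_sub (hN.add (i0.const_mul (b x))) hR).symm.trans (Eq.trans ?_ hparts)
  refine setIntegral_congr_fun measurableSet_Ioi fun y hy => ?_
  have h1 := hαa x y hx hy
  have h2 := hβb x y hx hy
  have h3 := hode (x + y) (add_pos hx hy)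
  simp only [Pi.add_apply]
  linear_combination (-(f y) * (a x - a y)) * h3 + f y * deriv φ (x + y) * h1
    - f y * φ (x + y) * h2
end

section
/- Let a : ℝ → ℝ be three times continuously differentiable and let α : ℝ → ℝ be differentiable. Suppose that α(x+y)·(a(x) − a(y)) = a'(x) − a'(y) for all x, y ∈ ℝ. Then there exists a constant A ∈ ℝ such that a'''(x) = A·a'(x) for all x ∈ ℝ. -/
/-- If `α (x + y) * (f x + ε * f y) = g x + ε * g y`, then differentiating in `x` gives
`α' (x + y) * (f x + ε * f y) + α (x + y) * f' x = g' x`. -/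
lemma deriv_of_mul_add_eq {α f g : ℝ → ℝ} (hα : Differentiable ℝ α) (hf : Differentiable ℝ f)
    (hg : Differentiable ℝ g) (ε : ℝ)
    (h : ∀ x y, α (x + y) * (f x + ε * f y) = g x + ε * g y) (x y : ℝ) :
    deriv α (x + y) * (f x + ε * f y) + α (x + y) * deriv f x = deriv g x := by
  have hα' : HasDerivAt (fun t ↦ α (t + y)) (deriv α (x + y)) x :=
    (hα (x + y)).hasDerivAt.comp_add_const x y
  have hl := hα'.mul ((hf x).hasDerivAt.add_const (ε * f y))
  have hr := (hg x).hasDerivAt.add_const (ε * g y)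
  refine hl.unique (hr.congr_of_eventuallyEq (Filter.Eventually.of_forall fun t ↦ ?_))
  exact h t y

/-- A differentiable function with `u x + u y = u (x + y) + u 0` has constant derivative. -/
lemma deriv_eq_deriv_zero_of_add_eq {u : ℝ → ℝ} (hu : Differentiable ℝ u)
    (h : ∀ x y, u x + u y = u (x + y) + u 0) (y : ℝ) : deriv u y = deriv u 0 := by
  have hl := (hu 0).hasDerivAt.add_const (u y)
  have hr : HasDerivAt (fun t ↦ u (t + y) + u 0) (deriv u (0 + y)) 0 :=
    ((hu (0 + y)).hasDerivAt.comp_add_const 0 y).add_const (u 0)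
  rw [zero_add] at hr
  refine hr.unique (hl.congr_of_eventuallyEq (Filter.Eventually.of_forall fun t ↦ ?_))
  exact (h t y).symm

/-- Lemma 2.2(i), forward direction: if there is a differentiable function `α` of the
single variable `x + y` with `α (x+y) * (a x - a y) = a' x - a' y` for all `x, y`,
then `a''' = A * a'` for some constant `A`. -/
theorem stmt_2 (a α : ℝ → ℝ) (ha : ContDiff ℝ 3 a) (hα : Differentiable ℝ α)
    (h : ∀ x y : ℝ, α (x + y) * (a x - a y) = deriv a x - deriv a y) :
    ∃ A : ℝ, ∀ x : ℝ, iteratedDeriv 3 a x = A * deriv a x := by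
  have d0 : Differentiable ℝ a := ha.differentiable (by norm_num)
  have d1 : Differentiable ℝ (deriv a) := by
    simpa [iteratedDeriv_succ] using ha.differentiable_iteratedDeriv 1 (by norm_num)
  have d2 : Differentiable ℝ (deriv (deriv a)) := by
    simpa [iteratedDeriv_succ] using ha.differentiable_iteratedDeriv 2 (by norm_num)
  simp only [iteratedDeriv_succ, iteratedDeriv_zero]
  set u := deriv a
  set w := deriv u with hw
  set v := deriv w with hv
  have first : ∀ x y, deriv α (x + y) * (a x + -1 * a y) + α (x + y) * u x = w x :=
    deriv_of_mul_add_eq hα d0 d1 (-1) fun x y ↦ by linear_combination h x y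
  have sum : ∀ x y, α (x + y) * (u x + u y) = w x + w y := fun x y ↦ by
    have h2 := first y x
    rw [add_comm y x] at h2
    linear_combination first x y + h2
  have second : ∀ x y, deriv α (x + y) * (u x + 1 * u y) + α (x + y) * w x = v x :=
    deriv_of_mul_add_eq hα d1 d2 1 fun x y ↦ by linear_combination sum x y
  have vdiff : ∀ x y, α (x + y) * (w x - w y) = v x - v y := fun x y ↦ by
    have h2 := second y x
    rw [add_comm y x] at h2
    linear_combination second x y - h2
  have vsum : ∀ x y, (2 * deriv α (x + y) + α (x + y) ^ 2) * (u x + u y) = v x + v y :=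
    fun x y ↦ by
      have h2 := second y x
      rw [add_comm y x] at h2
      linear_combination second x y + h2 + α (x + y) * sum x y
  have wronskian : ∀ x y, (w x + w y) * (w x - w y) = (v x - v y) * (u x + u y) :=
    fun x y ↦ by
      linear_combination (u x + u y) * vdiff x y - (w x - w y) * sum x y
  have of_const : (∀ x, w x = w 0) → ∃ A : ℝ, ∀ x, v x = A * u x := fun hc ↦ by
    refine ⟨0, fun x ↦ ?_⟩
    rw [hv, show w = fun _ ↦ w 0 from funext hc]
    simp
  by_cases hu : ∃ p, u p ≠ u 0
  · obtain ⟨p, hp⟩ := hu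
    have hp' : u p - u 0 ≠ 0 := sub_ne_zero.mpr hp
    obtain ⟨A, hA⟩ : ∃ A, A * (u p - u 0) = v p - v 0 := ⟨_, div_mul_cancel₀ _ hp'⟩
    obtain ⟨B, hB⟩ : ∃ B, B = v 0 - A * u 0 := ⟨_, rfl⟩
    have affine : ∀ x, v x = A * u x + B := fun x ↦ by
      apply mul_right_cancel₀ hp'
      linear_combination -wronskian x p - wronskian p 0 - wronskian 0 x
        - (u x - u 0) * hA - (u p - u 0) * hB
    by_cases hB0 : B = 0
    · exact ⟨A, fun x ↦ by rw [affine, hB0, add_zero]⟩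
    · have key : ∀ x y,
          (2 * deriv α (x + y) + α (x + y) ^ 2 - A) * (u x + u y) = 2 * B := fun x y ↦ by
        linear_combination vsum x y + affine x + affine y
      refine of_const (deriv_eq_deriv_zero_of_add_eq d1 fun x y ↦ ?_)
      have h1 := key x y
      have h2 := key (x + y) 0
      rw [add_zero] at h2
      exact mul_left_cancel₀ (left_ne_zero_of_mul (h1.trans_ne (by simpa using hB0)))
        (h1.trans h2.symm)
  · push Not at hu
    refine of_const fun x ↦ ?_
    rw [hw, show u = fun _ ↦ u 0 from funext hu]
    simp
end

section
/- Let a : ℝ → ℝ be three times continuously differentiable and suppose there is a constant A ∈ ℝ with a'''(x) = A·a'(x) for all x ∈ ℝ. Then for all x₁, y₁, x₂, y₂ ∈ ℝ with x₁ + y₁ = x₂ + y₂, one has (a'(x₁) − a'(y₁))·(a(x₂) − a(y₂)) = (a'(x₂) − a'(y₂))·(a(x₁) − a(y₁)). In particular the ratio (a'(x) − a'(y))/(a(x) − a(y)) depends only on x + y wherever a(x) ≠ a(y), so there exists a function α with α(x+y) = (a'(x) − a'(y))/(a(x) − a(y)) whenever a(x) ≠ a(y). -/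
/-- A solution of the linear equation `y'' = A y` with vanishing initial data is zero. -/
theorem eq_zero_of_hasDerivAt_of_hasDerivAt_mul {A : ℝ} {y z : ℝ → ℝ}
    (hy : ∀ t, HasDerivAt y (z t) t) (hz : ∀ t, HasDerivAt z (A * y t) t)
    (hy0 : y 0 = 0) (hz0 : z 0 = 0) (t : ℝ) : y t = 0 := by
  let L : ℝ × ℝ →L[ℝ] ℝ × ℝ :=
    (ContinuousLinearMap.snd ℝ ℝ ℝ).prod (A • ContinuousLinearMap.fst ℝ ℝ ℝ)
  have key : (fun t => (y t, z t)) = fun _ => (0 : ℝ × ℝ) :=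
    ODE_solution_unique_univ (v := fun _ => L) (s := fun _ => Set.univ) (t₀ := 0)
      (fun _ => L.lipschitz.lipschitzOnWith)
      (fun t => ⟨(hy t).prodMk (hz t), Set.mem_univ _⟩)
      (fun t => ⟨by simpa using hasDerivAt_const t (0 : ℝ × ℝ), Set.mem_univ _⟩)
      (by simp [hy0, hz0])
  exact congrArg Prod.fst (congrFun key t)

/-- Two solutions of `y'' = A y` that vanish at `0` are linearly dependent. -/
theorem mul_eq_mul_of_hasDerivAt_of_hasDerivAt_mul {A : ℝ} {f f' g g' : ℝ → ℝ}
    (hf : ∀ t, HasDerivAt f (f' t) t) (hf' : ∀ t, HasDerivAt f' (A * f t) t)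
    (hg : ∀ t, HasDerivAt g (g' t) t) (hg' : ∀ t, HasDerivAt g' (A * g t) t)
    (hf0 : f 0 = 0) (hg0 : g 0 = 0) (s t : ℝ) : f s * g t = f t * g s := by
  by_cases hg0' : g' 0 = 0
  · have hzero := eq_zero_of_hasDerivAt_of_hasDerivAt_mul hg hg' hg0 hg0'
    simp [hzero]
  · have key : ∀ r, f r * g' 0 - g r * f' 0 = 0 :=
      eq_zero_of_hasDerivAt_of_hasDerivAt_mul (A := A)
        (z := fun r => f' r * g' 0 - g' r * f' 0)
        (fun r => ((hf r).mul_const _).sub ((hg r).mul_const _))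
        (fun r => (((hf' r).mul_const _).sub ((hg' r).mul_const _)).congr_deriv (by ring))
        (by simp [hf0, hg0]) (by ring)
    apply mul_right_cancel₀ hg0'
    linear_combination g t * key s - g s * key t

/-- Differentiating the odd part of a function about `m` gives the even part of its derivative. -/
theorem HasDerivAt.add_sub_comp_sub {f f' : ℝ → ℝ} (hf : ∀ x, HasDerivAt f (f' x) x) (m t : ℝ) :
    HasDerivAt (fun t => f (m + t) - f (m - t)) (f' (m + t) + f' (m - t)) t :=
  (((hf (m + t)).comp_const_add m t).sub ((hf (m - t)).comp_const_sub m t)).congr_deriv (by ring)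

/-- Differentiating the even part of a function about `m` gives the odd part of its derivative. -/
theorem HasDerivAt.add_add_comp_sub {f f' : ℝ → ℝ} (hf : ∀ x, HasDerivAt f (f' x) x) (m t : ℝ) :
    HasDerivAt (fun t => f (m + t) + f (m - t)) (f' (m + t) - f' (m - t)) t :=
  (((hf (m + t)).comp_const_add m t).add ((hf (m - t)).comp_const_sub m t)).congr_deriv (by ring)


/-- Lemma 2.2(i), converse direction: if `a''' = A * a'`, then the ratio
`(a' x - a' y) / (a x - a y)` depends only on `x + y` (stated in cross-multiplied form),
so there is a function `α` with `α (x+y) = (a' x - a' y) / (a x - a y)`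
whenever `a x ≠ a y`. -/
theorem stmt_3 (a : ℝ → ℝ) (ha : ContDiff ℝ 3 a) (A : ℝ)
    (h : ∀ x : ℝ, iteratedDeriv 3 a x = A * deriv a x) :
    (∀ x₁ y₁ x₂ y₂ : ℝ, x₁ + y₁ = x₂ + y₂ →
      (deriv a x₁ - deriv a y₁) * (a x₂ - a y₂)
        = (deriv a x₂ - deriv a y₂) * (a x₁ - a y₁)) ∧
    ∃ α : ℝ → ℝ, ∀ x y : ℝ, a x ≠ a y →
      α (x + y) = (deriv a x - deriv a y) / (a x - a y) := by
  have h0 : ∀ x, HasDerivAt a (deriv a x) x := fun x =>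
    (ha.differentiable (by norm_num) x).hasDerivAt
  have h1 : ∀ x, HasDerivAt (deriv a) (iteratedDeriv 2 a x) x := fun x => by
    have hd := (ha.differentiable_iteratedDeriv 1 (by norm_num) x).hasDerivAt
    rwa [← iteratedDeriv_succ, iteratedDeriv_one] at hd
  have h2 : ∀ x, HasDerivAt (iteratedDeriv 2 a) (A * deriv a x) x := fun x => by
    have hd := (ha.differentiable_iteratedDeriv 2 (by norm_num) x).hasDerivAt
    rwa [← iteratedDeriv_succ, h] at hd
  have hconst : ∀ x y, iteratedDeriv 2 a x - A * a x = iteratedDeriv 2 a y - A * a y := by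
    have hd : ∀ x, HasDerivAt (fun x => iteratedDeriv 2 a x - A * a x) 0 x := fun x =>
      ((h2 x).sub ((h0 x).const_mul A)).congr_deriv (sub_self _)
    exact is_const_of_deriv_eq_zero (fun x => (hd x).differentiableAt) fun x => (hd x).deriv
  have cross : ∀ x₁ y₁ x₂ y₂ : ℝ, x₁ + y₁ = x₂ + y₂ →
      (deriv a x₁ - deriv a y₁) * (a x₂ - a y₂)
        = (deriv a x₂ - deriv a y₂) * (a x₁ - a y₁) := by
    intro x₁ y₁ x₂ y₂ hxy
    obtain ⟨m, hm⟩ : ∃ m, m = (x₁ + y₁) / 2 := ⟨_, rfl⟩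
    have key := mul_eq_mul_of_hasDerivAt_of_hasDerivAt_mul (A := A)
      (HasDerivAt.add_sub_comp_sub h1 m)
      (fun t => (HasDerivAt.add_add_comp_sub h2 m t).congr_deriv (by ring))
      (HasDerivAt.add_sub_comp_sub h0 m)
      (fun t => (HasDerivAt.add_add_comp_sub h1 m t).congr_deriv
        (by linear_combination hconst (m + t) (m - t)))
      (by simp) (by simp) (x₁ - m) (x₂ - m)
    have e₁ : m - (x₁ - m) = y₁ := by linarith
    have e₂ : m - (x₂ - m) = y₂ := by linarith
    simpa only [add_sub_cancel, e₁, e₂] using key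
  refine ⟨cross, ?_⟩
  classical
  refine ⟨fun s => if hs : ∃ p : ℝ × ℝ, p.1 + p.2 = s ∧ a p.1 ≠ a p.2 then
    (deriv a hs.choose.1 - deriv a hs.choose.2) / (a hs.choose.1 - a hs.choose.2) else 0, ?_⟩
  intro x y hxy
  have hs : ∃ p : ℝ × ℝ, p.1 + p.2 = x + y ∧ a p.1 ≠ a p.2 := ⟨(x, y), rfl, hxy⟩
  obtain ⟨hsum, hne⟩ := hs.choose_spec
  simp only [dif_pos hs]
  rw [div_eq_div_iff (sub_ne_zero.mpr hne) (sub_ne_zero.mpr hxy)]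
  exact cross _ _ _ _ hsum
end

section
/- Let a : ℝ → ℝ be three times continuously differentiable and suppose there is a constant A ∈ ℝ with a'''(x) = A·a'(x) for all x ∈ ℝ. Then there exist differentiable functions f, g : ℝ → ℝ such that a(x) − a(y) = f(x+y)·g(x−y) for all x, y ∈ ℝ. -/
/-- The equation `C' = A * S`, `S' = C` with `S 0 = 0`, `C 0 = 1` has a global solution, and it
satisfies the Pythagorean identity. -/
lemma exists_generalized_sin_cos (A : ℝ) :
    ∃ S C : ℝ → ℝ, (∀ t, HasDerivAt S (C t) t) ∧ (∀ t, HasDerivAt C (A * S t) t) ∧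
      S 0 = 0 ∧ C 0 = 1 ∧ ∀ t, C t ^ 2 - A * S t ^ 2 = 1 := by
  rcases lt_trichotomy A 0 with hA | rfl | hA
  · obtain ⟨k, hk, rfl⟩ : ∃ k : ℝ, k ≠ 0 ∧ A = -k ^ 2 :=
      ⟨√(-A), (Real.sqrt_pos.2 (by linarith)).ne', by rw [Real.sq_sqrt (by linarith)]; ring⟩
    have hlin (t : ℝ) : HasDerivAt (fun t : ℝ => k * t) k t := by
      simpa using (hasDerivAt_id t).const_mul k
    refine ⟨fun t => Real.sin (k * t) / k, fun t => Real.cos (k * t), fun t => ?_, fun t => ?_,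
      by simp, by simp, fun t => ?_⟩
    · refine HasDerivAt.congr_deriv ((hlin t).sin.div_const k) ?_
      field_simp
    · refine HasDerivAt.congr_deriv ((hlin t).cos) ?_
      field_simp
    · field_simp
      linarith [Real.sin_sq_add_cos_sq (k * t)]
  · exact ⟨fun t => t, fun _ => 1, fun t => hasDerivAt_id t,
      fun t => by simpa using hasDerivAt_const t (1 : ℝ), rfl, rfl, fun t => by simp⟩
  · obtain ⟨k, hk, rfl⟩ : ∃ k : ℝ, k ≠ 0 ∧ A = k ^ 2 :=
      ⟨√A, (Real.sqrt_pos.2 hA).ne', (Real.sq_sqrt hA.le).symm⟩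
    have hlin (t : ℝ) : HasDerivAt (fun t : ℝ => k * t) k t := by
      simpa using (hasDerivAt_id t).const_mul k
    refine ⟨fun t => Real.sinh (k * t) / k, fun t => Real.cosh (k * t), fun t => ?_, fun t => ?_,
      by simp, by simp, fun t => ?_⟩
    · refine HasDerivAt.congr_deriv ((hlin t).sinh.div_const k) ?_
      field_simp
    · refine HasDerivAt.congr_deriv ((hlin t).cosh) ?_
      field_simp
    · field_simp
      linarith [Real.cosh_sq_sub_sinh_sq (k * t)]

lemma eq_of_forall_hasDerivAt_zero {F : ℝ → ℝ} (hF : ∀ t, HasDerivAt F 0 t) (x y : ℝ) :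
    F x = F y :=
  is_const_of_deriv_eq_zero (fun t => (hF t).differentiableAt) (fun t => (hF t).deriv) x y

/-- Uniqueness for `w'' = A * w` with zero initial data. -/
lemma eq_zero_of_second_deriv_eq_mul {A : ℝ} {w v : ℝ → ℝ} (hw : ∀ t, HasDerivAt w (v t) t)
    (hv : ∀ t, HasDerivAt v (A * w t) t) (hw0 : w 0 = 0) (hv0 : v 0 = 0) (t : ℝ) : w t = 0 := by
  obtain ⟨S, C, hS, hC, -, -, hSC⟩ := exists_generalized_sin_cos A
  have h₁ : w t * C t - v t * S t = w 0 * C 0 - v 0 * S 0 :=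
    eq_of_forall_hasDerivAt_zero (F := fun t => w t * C t - v t * S t) (fun t => by
      refine HasDerivAt.congr_deriv (((hw t).fun_mul (hC t)).fun_sub ((hv t).fun_mul (hS t))) ?_
      ring) t 0
  have h₂ : v t * C t - A * (w t * S t) = v 0 * C 0 - A * (w 0 * S 0) :=
    eq_of_forall_hasDerivAt_zero (F := fun t => v t * C t - A * (w t * S t)) (fun t => by
      refine HasDerivAt.congr_deriv (((hv t).fun_mul (hC t)).fun_sub (((hw t).fun_mul (hS t)).const_mul A)) ?_
      ring) t 0
  simp only [hw0, hv0, zero_mul, mul_zero, sub_zero] at h₁ h₂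
  linear_combination C t * h₁ + S t * h₂ - w t * hSC t

/-- Lemma 2.2(ii): if `a''' = A * a'`, then `a x - a y` factorizes as
`f (x+y) * g (x-y)` for some differentiable functions `f` and `g`. -/
theorem stmt_4 (a : ℝ → ℝ) (ha : ContDiff ℝ 3 a) (A : ℝ)
    (h : ∀ x : ℝ, iteratedDeriv 3 a x = A * deriv a x) :
    ∃ f g : ℝ → ℝ, Differentiable ℝ f ∧ Differentiable ℝ g ∧
      ∀ x y : ℝ, a x - a y = f (x + y) * g (x - y) := by
  obtain ⟨S, C, hS, hC, hS0, hC0, -⟩ := exists_generalized_sin_cos A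
  have d₀ (t : ℝ) : HasDerivAt a (deriv a t) t := (ha.differentiable (by norm_num) t).hasDerivAt
  have d₁ (t : ℝ) : HasDerivAt (deriv a) (deriv (deriv a) t) t := by
    have := ha.differentiable_iteratedDeriv 1 (by norm_num) t
    rw [iteratedDeriv_one] at this
    exact this.hasDerivAt
  have d₂ (t : ℝ) : HasDerivAt (deriv (deriv a)) (A * deriv a t) t := by
    have := (ha.differentiable_iteratedDeriv 2 (by norm_num) t).hasDerivAt
    rwa [← iteratedDeriv_succ, h, iteratedDeriv_succ, iteratedDeriv_one] at this
  have key (m t : ℝ) : a (m + t) - a (m - t) = deriv a m * (2 * S t) := by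
    have hw (t : ℝ) : deriv a (m + t) + deriv a (m - t) - deriv a m * (2 * C t) = 0 := by
      refine eq_zero_of_second_deriv_eq_mul (A := A)
        (w := fun t => deriv a (m + t) + deriv a (m - t) - deriv a m * (2 * C t))
        (v := fun t => deriv (deriv a) (m + t) - deriv (deriv a) (m - t)
          - deriv a m * (2 * (A * S t))) (fun t => ?_) (fun t => ?_) ?_ ?_ t
      · refine HasDerivAt.congr_deriv ((((d₁ (m + t)).comp_const_add m t).fun_add
          ((d₁ (m - t)).comp_const_sub m t)).fun_sub
          (((hC t).const_mul 2).const_mul (deriv a m))) ?_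
        ring
      · refine HasDerivAt.congr_deriv ((((d₂ (m + t)).comp_const_add m t).fun_sub
          ((d₂ (m - t)).comp_const_sub m t)).fun_sub
          ((((hS t).const_mul A).const_mul 2).const_mul (deriv a m))) ?_
        ring
      · simp [hC0]; ring
      · simp [hS0]
    have hD := eq_of_forall_hasDerivAt_zero
      (F := fun t => a (m + t) - a (m - t) - deriv a m * (2 * S t)) (fun t => by
        refine HasDerivAt.congr_deriv ((((d₀ (m + t)).comp_const_add m t).fun_sub
          ((d₀ (m - t)).comp_const_sub m t)).fun_sub
          (((hS t).const_mul 2).const_mul (deriv a m))) ?_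
        linarith [hw t]) t 0
    simp only [add_zero, sub_zero, sub_self, hS0, mul_zero] at hD
    linarith
  have d₁' : Differentiable ℝ (deriv a) := fun t => (d₁ t).differentiableAt
  have hS' : Differentiable ℝ S := fun t => (hS t).differentiableAt
  refine ⟨fun s => deriv a (s / 2), fun d => 2 * S (d / 2), by fun_prop, by fun_prop,
    fun x y => ?_⟩
  convert key ((x + y) / 2) ((x - y) / 2) using 3 <;> ring
end

section
/- Let b : ℝ → ℝ be three times continuously differentiable and nonconstant, and let g, h : ℝ → ℝ be differentiable functions with g(t) ≠ 0 for all t ≠ 0. Suppose that b(x) − b(y) = g(x−y)·h(x+y) for all x, y ∈ ℝ. Then there exists a constant B ∈ ℝ such that b'''(x) = B·b'(x) for all x ∈ ℝ. -/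
/-- Derivative of the symmetric difference of `b` about `y` with respect to the increment. -/
theorem hasDerivAt_symm_sub {b b₁ : ℝ → ℝ} (h₁ : ∀ x, HasDerivAt b (b₁ x) x) (y t : ℝ) :
    HasDerivAt (fun s => b (y + s) - b (y - s)) (b₁ (y + t) + b₁ (y - t)) t := by
  simpa using ((h₁ (y + t)).comp_const_add y t).fun_sub ((h₁ (y - t)).comp_const_sub y t)

/-- If the symmetric differences of `b` about `x` are those about `x₀`, up to a constant factor
and the derivative of `b` at `x`, then comparing second derivatives in `t` and in `x` relates the
first and third derivatives of `b`. -/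
theorem third_deriv_identity {b b₁ b₂ b₃ : ℝ → ℝ}
    (h₁ : ∀ x, HasDerivAt b (b₁ x) x) (h₂ : ∀ x, HasDerivAt b₁ (b₂ x) x)
    (h₃ : ∀ x, HasDerivAt b₂ (b₃ x) x) {a x₀ : ℝ}
    (hid : ∀ x t, (b (x + t) - b (x - t)) * a = (b (x₀ + t) - b (x₀ - t)) * b₁ x) (x t : ℝ) :
    (b₂ (x₀ + t) - b₂ (x₀ - t)) * b₁ x = (b (x₀ + t) - b (x₀ - t)) * b₃ x := by
  have ht₁ : ∀ x t, (b₁ (x + t) + b₁ (x - t)) * a = (b₁ (x₀ + t) + b₁ (x₀ - t)) * b₁ x := by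
    intro x t
    have hl := (hasDerivAt_symm_sub h₁ x t).mul_const a
    rw [funext (hid x)] at hl
    exact hl.unique ((hasDerivAt_symm_sub h₁ x₀ t).mul_const _)
  have ht₂ : (b₂ (x + t) - b₂ (x - t)) * a = (b₂ (x₀ + t) - b₂ (x₀ - t)) * b₁ x := by
    have key : ∀ y, HasDerivAt (fun s => b₁ (y + s) + b₁ (y - s)) (b₂ (y + t) - b₂ (y - t)) t := by
      intro y
      simpa [sub_eq_add_neg] using
        ((h₂ (y + t)).comp_const_add y t).fun_add ((h₂ (y - t)).comp_const_sub y t)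
    have hl := (key x).mul_const a
    rw [funext (ht₁ x)] at hl
    exact hl.unique ((key x₀).mul_const _)
  have hx₁ : ∀ x, (b₁ (x + t) - b₁ (x - t)) * a = (b (x₀ + t) - b (x₀ - t)) * b₂ x := by
    intro x
    have hl := (((h₁ (x + t)).comp_add_const x t).sub ((h₁ (x - t)).comp_sub_const x t)).mul_const a
    have hr := (h₂ x).const_mul (b (x₀ + t) - b (x₀ - t))
    rw [← funext fun y => hid y t] at hr
    exact hl.unique hr
  have hx₂ : (b₂ (x + t) - b₂ (x - t)) * a = (b (x₀ + t) - b (x₀ - t)) * b₃ x := by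
    have hl := (((h₂ (x + t)).comp_add_const x t).sub ((h₂ (x - t)).comp_sub_const x t)).mul_const a
    have hr := (h₃ x).const_mul (b (x₀ + t) - b (x₀ - t))
    rw [← funext hx₁] at hr
    exact hl.unique hr
  rw [← ht₂, hx₂]

/-- Lemma 2.2(iii): if `b` is nonconstant and `b x - b y = g (x-y) * h (x+y)` for
differentiable `g`, `h` with `g t ≠ 0` for `t ≠ 0`, then `b''' = B * b'` for some
constant `B`. -/
theorem stmt_5 (b g h : ℝ → ℝ) (hb : ContDiff ℝ 3 b)
    (hbnc : ∃ x y : ℝ, b x ≠ b y)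
    (hg : Differentiable ℝ g) (hh : Differentiable ℝ h)
    (hg0 : ∀ t : ℝ, t ≠ 0 → g t ≠ 0)
    (heq : ∀ x y : ℝ, b x - b y = g (x - y) * h (x + y)) :
    ∃ B : ℝ, ∀ x : ℝ, iteratedDeriv 3 b x = B * deriv b x := by
  have hd : ∀ n : ℕ, n < 3 → ∀ x,
      HasDerivAt (iteratedDeriv n b) (iteratedDeriv (n + 1) b x) x := by
    intro n hn x
    rw [iteratedDeriv_succ]
    exact (hb.differentiable_iteratedDeriv n (by exact_mod_cast hn) x).hasDerivAt
  have h₁ : ∀ x, HasDerivAt b (deriv b x) x := by simpa using hd 0 (by norm_num)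
  have h₂ : ∀ x, HasDerivAt (deriv b) (iteratedDeriv 2 b x) x := by
    simpa [iteratedDeriv_one] using hd 1 (by norm_num)
  have hD : ∀ x t, b (x + t) - b (x - t) = g (2 * t) * h (2 * x) := by
    intro x t
    rw [heq]
    ring_nf
  obtain ⟨p, q, hpq⟩ := hbnc
  obtain ⟨x₀, hx₀⟩ : ∃ x₀, h (2 * x₀) ≠ 0 := by
    refine ⟨(p + q) / 2, fun h0 => hpq (sub_eq_zero.1 ?_)⟩
    rw [mul_div_cancel₀ _ two_ne_zero] at h0
    rw [heq, h0, mul_zero]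
  have hcross : ∀ x t, (b (x + t) - b (x - t)) * h (2 * x₀)
      = (b (x₀ + t) - b (x₀ - t)) * h (2 * x) := by
    intro x t
    rw [hD, hD]
    ring
  have hlin : ∀ x, deriv b x * h (2 * x₀) = deriv b x₀ * h (2 * x) := by
    intro x
    have hl := (hasDerivAt_symm_sub h₁ x 0).mul_const (h (2 * x₀))
    rw [funext (hcross x)] at hl
    have := hl.unique ((hasDerivAt_symm_sub h₁ x₀ 0).mul_const _)
    simp only [add_zero, sub_zero] at this
    linarith
  have hid : ∀ x t, (b (x + t) - b (x - t)) * deriv b x₀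
      = (b (x₀ + t) - b (x₀ - t)) * deriv b x := by
    intro x t
    apply mul_right_cancel₀ hx₀
    linear_combination deriv b x₀ * hcross x t - (b (x₀ + t) - b (x₀ - t)) * hlin x
  have hne : b (x₀ + 1) - b (x₀ - 1) ≠ 0 := by
    rw [hD]
    exact mul_ne_zero (hg0 _ (by norm_num)) hx₀
  refine ⟨(iteratedDeriv 2 b (x₀ + 1) - iteratedDeriv 2 b (x₀ - 1)) /
    (b (x₀ + 1) - b (x₀ - 1)), fun x => ?_⟩
  rw [div_mul_eq_mul_div, eq_div_iff hne,
    third_deriv_identity h₁ h₂ (hd 2 (by norm_num)) hid x 1, mul_comm]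
end

section
/- Let h₁, h₂, h₄, h₅ be real constants such that h₁ sinh u + h₂ cosh u ≠ 0 for all u > 0, and set α(u) = (2h₁ cosh u + 2h₂ sinh u)/(h₁ sinh u + h₂ cosh u) and β(u) = (h₄ sinh u + h₅ cosh u)/(h₁ sinh u + h₂ cosh u). Suppose φ : (0,∞) → ℝ is twice continuously differentiable and satisfies φ''(u) + α(u)φ'(u) − β(u)φ(u) = 0 for all u > 0. Define ψ : (0,1) → ℝ by ψ(x) = φ(−(1/2)·log x). Then ψ satisfies, for all x ∈ (0,1), ψ''(x) + [2(h₂ − h₁)/(h₁ + h₂ + (h₂ − h₁)x)]·ψ'(x) − [(h₄ + h₅ + (h₅ − h₄)x)/(4x²·(h₁ + h₂ + (h₂ − h₁)x))]·ψ(x) = 0. -/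
/-- `sinh` under the substitution `x = e^{-2u}`, cleared of denominators. -/
lemma two_mul_exp_neg_mul_sinh (u : ℝ) :
    2 * Real.exp (-u) * Real.sinh u = 1 - Real.exp (-2 * u) := by
  have h : Real.exp (-u) * Real.exp u = 1 := by rw [← Real.exp_add]; simp
  have h2 : Real.exp (-2 * u) = Real.exp (-u) * Real.exp (-u) := by
    rw [← Real.exp_add]; ring_nf
  rw [Real.sinh_eq, h2]
  linear_combination h

/-- `cosh` under the substitution `x = e^{-2u}`, cleared of denominators. -/
lemma two_mul_exp_neg_mul_cosh (u : ℝ) :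
    2 * Real.exp (-u) * Real.cosh u = 1 + Real.exp (-2 * u) := by
  have h : Real.exp (-u) * Real.exp u = 1 := by rw [← Real.exp_add]; simp
  have h2 : Real.exp (-2 * u) = Real.exp (-u) * Real.exp (-u) := by
    rw [← Real.exp_add]; ring_nf
  rw [Real.cosh_eq, h2]
  linear_combination h

lemma neg_half_mul_log_pos {x : ℝ} (hx : x ∈ Set.Ioo (0 : ℝ) 1) :
    0 < -(1/2) * Real.log x := by
  linarith [Real.log_neg hx.1 hx.2]

lemma hasDerivAt_comp_neg_half_mul_log {f : ℝ → ℝ} {x : ℝ} (hx : x ≠ 0)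
    (hf : DifferentiableAt ℝ f (-(1/2) * Real.log x)) :
    HasDerivAt (fun x : ℝ => f (-(1/2) * Real.log x))
      (deriv f (-(1/2) * Real.log x) * (-(1/2) * x⁻¹)) x :=
  hf.hasDerivAt.comp x ((Real.hasDerivAt_log hx).const_mul (-(1/2)))


/-- Proposition 4.2(i) (with `t = 2`): under the change of variable `x = e^{-2u}`,
the equation `φ'' + α φ' - β φ = 0` in the hyperbolic case becomes the stated
second-order equation with rational coefficients on `(0,1)`. -/
theorem stmt_9 (h₁ h₂ h₄ h₅ : ℝ)
    (hne : ∀ u : ℝ, 0 < u → h₁ * Real.sinh u + h₂ * Real.cosh u ≠ 0)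
    (φ : ℝ → ℝ) (hφ : ContDiffOn ℝ 2 φ (Set.Ioi 0))
    (hode : ∀ u : ℝ, 0 < u →
      deriv (deriv φ) u
        + ((2 * h₁ * Real.cosh u + 2 * h₂ * Real.sinh u)
            / (h₁ * Real.sinh u + h₂ * Real.cosh u)) * deriv φ u
        - ((h₄ * Real.sinh u + h₅ * Real.cosh u)
            / (h₁ * Real.sinh u + h₂ * Real.cosh u)) * φ u = 0) :
    ∀ x : ℝ, x ∈ Set.Ioo (0:ℝ) 1 →
      deriv (deriv (fun x : ℝ => φ (-(1/2) * Real.log x))) x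
        + (2 * (h₂ - h₁) / (h₁ + h₂ + (h₂ - h₁) * x))
            * deriv (fun x : ℝ => φ (-(1/2) * Real.log x)) x
        - ((h₄ + h₅ + (h₅ - h₄) * x) / (4 * x ^ 2 * (h₁ + h₂ + (h₂ - h₁) * x)))
            * φ (-(1/2) * Real.log x) = 0 := by
  intro x hx
  have hx0 : x ≠ 0 := hx.1.ne'
  have hd : ∀ u : ℝ, 0 < u → DifferentiableAt ℝ φ u := fun u hu =>
    (hφ.differentiableOn (by norm_num)).differentiableAt (Ioi_mem_nhds hu)
  have hd2 : ∀ u : ℝ, 0 < u → DifferentiableAt ℝ (deriv φ) u := fun u hu =>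
    ((hφ.deriv_of_isOpen (m := 1) isOpen_Ioi (by norm_num)).differentiableOn
      (by norm_num)).differentiableAt (Ioi_mem_nhds hu)
  have hψ : ∀ y ∈ Set.Ioo (0 : ℝ) 1, deriv (fun x : ℝ => φ (-(1/2) * Real.log x)) y
      = deriv φ (-(1/2) * Real.log y) * (-(1/2) * y⁻¹) := fun y hy =>
    (hasDerivAt_comp_neg_half_mul_log hy.1.ne' (hd _ (neg_half_mul_log_pos hy))).deriv
  have hu := neg_half_mul_log_pos hx
  have hψ2 : deriv (deriv (fun x : ℝ => φ (-(1/2) * Real.log x))) x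
      = deriv (deriv φ) (-(1/2) * Real.log x) * (-(1/2) * x⁻¹) * (-(1/2) * x⁻¹)
        + deriv φ (-(1/2) * Real.log x) * (-(1/2) * -(x ^ 2)⁻¹) := by
    have heq : deriv (fun x : ℝ => φ (-(1/2) * Real.log x)) =ᶠ[nhds x]
        fun y => deriv φ (-(1/2) * Real.log y) * (-(1/2) * y⁻¹) :=
      Filter.eventually_of_mem (Ioo_mem_nhds hx.1 hx.2) hψ
    rw [heq.deriv_eq]
    exact ((hasDerivAt_comp_neg_half_mul_log hx0 (hd2 _ hu)).mul
      ((hasDerivAt_inv hx0).const_mul (-(1/2)))).deriv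
  rw [hψ2, hψ x hx]
  have hode' := hode _ hu
  have hne' := hne _ hu
  have hs := two_mul_exp_neg_mul_sinh (-(1/2) * Real.log x)
  have hc := two_mul_exp_neg_mul_cosh (-(1/2) * Real.log x)
  have hexp : Real.exp (-2 * (-(1/2) * Real.log x)) = x := by
    rw [show -2 * (-(1/2) * Real.log x) = Real.log x by ring, Real.exp_log hx.1]
  rw [hexp] at hs hc
  generalize -(1/2) * Real.log x = u at *
  have hE : 2 * Real.exp (-u) ≠ 0 := by positivity
  have hD : h₁ + h₂ + (h₂ - h₁) * x
      = 2 * Real.exp (-u) * (h₁ * Real.sinh u + h₂ * Real.cosh u) := by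
    linear_combination -h₁ * hs - h₂ * hc
  have hD0 : h₁ + h₂ + (h₂ - h₁) * x ≠ 0 := hD ▸ mul_ne_zero hE hne'
  have hα : (2 * h₁ * Real.cosh u + 2 * h₂ * Real.sinh u)
      / (h₁ * Real.sinh u + h₂ * Real.cosh u)
      = 2 * (h₁ + h₂ + (h₁ - h₂) * x) / (h₁ + h₂ + (h₂ - h₁) * x) := by
    rw [hD, ← mul_div_mul_left _ _ hE]
    congr 1
    linear_combination 2 * h₁ * hc + 2 * h₂ * hs
  have hβ : (h₄ * Real.sinh u + h₅ * Real.cosh u)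
      / (h₁ * Real.sinh u + h₂ * Real.cosh u)
      = (h₄ + h₅ + (h₅ - h₄) * x) / (h₁ + h₂ + (h₂ - h₁) * x) := by
    rw [hD, ← mul_div_mul_left _ _ hE]
    congr 1
    linear_combination h₄ * hs + h₅ * hc
  rw [hα, hβ] at hode'
  have hnum : 2 * (h₁ + h₂ + (h₁ - h₂) * x)
      = 2 * (h₁ + h₂ + (h₂ - h₁) * x) - 4 * (h₂ - h₁) * x := by ring
  rw [hnum] at hode'
  clear hD hα hβ hnum
  generalize h₁ + h₂ + (h₂ - h₁) * x = D at *
  refine Eq.trans ?_ (mul_eq_zero_of_right (1 / (4 * x ^ 2)) hode')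
  field_simp
  ring
end

section
/- Let c₁, c₂, c₄, c₅ be real constants, and let I ⊆ (0, π/2) be an open interval such that c₂ cos u − c₁ sin u ≠ 0 for all u ∈ I. Set α(u) = (−2c₁ cos u − 2c₂ sin u)/(−c₁ sin u + c₂ cos u) and β(u) = (−c₄ sin u + c₅ cos u)/(−c₁ sin u + c₂ cos u). Suppose φ : I → ℝ is twice continuously differentiable and satisfies φ''(u) + α(u)φ'(u) − β(u)φ(u) = 0 for all u ∈ I. Define ψ on tan(I) by ψ(τ) = φ(arctan τ). Then ψ satisfies, for all τ ∈ tan(I), ψ''(τ) + [2c₁/(c₁τ − c₂)]·ψ'(τ) − [(−c₄τ + c₅)/((−c₁τ + c₂)·(1 + τ²)²)]·ψ(τ) = 0. -/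
/-- Proposition 5.2(i) (with `t = 2`): under the change of variable `τ = tan u`,
the equation `φ'' + α φ' - β φ = 0` in the circular case becomes the stated
second-order equation with rational coefficients on `tan(I)`. -/
theorem stmt_10 (c₁ c₂ c₄ c₅ : ℝ) (a b : ℝ)
    (hI : Set.Ioo a b ⊆ Set.Ioo 0 (Real.pi / 2))
    (hne : ∀ u : ℝ, u ∈ Set.Ioo a b → c₂ * Real.cos u - c₁ * Real.sin u ≠ 0)
    (φ : ℝ → ℝ) (hφ : ContDiffOn ℝ 2 φ (Set.Ioo a b))
    (hode : ∀ u : ℝ, u ∈ Set.Ioo a b →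
      deriv (deriv φ) u
        + ((-2 * c₁ * Real.cos u - 2 * c₂ * Real.sin u)
            / (-c₁ * Real.sin u + c₂ * Real.cos u)) * deriv φ u
        - ((-c₄ * Real.sin u + c₅ * Real.cos u)
            / (-c₁ * Real.sin u + c₂ * Real.cos u)) * φ u = 0) :
    ∀ τ : ℝ, τ ∈ Real.tan '' Set.Ioo a b →
      deriv (deriv (fun τ : ℝ => φ (Real.arctan τ))) τ
        + (2 * c₁ / (c₁ * τ - c₂)) * deriv (fun τ : ℝ => φ (Real.arctan τ)) τ
        - ((-c₄ * τ + c₅) / ((-c₁ * τ + c₂) * (1 + τ ^ 2) ^ 2))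
            * φ (Real.arctan τ) = 0 := by
  rintro _ ⟨u, hu, rfl⟩
  have hlo : -(Real.pi / 2) < u := by linarith [(hI hu).1, Real.pi_pos]
  have hu_arctan : Real.arctan (Real.tan u) = u := Real.arctan_tan hlo (hI hu).2
  have hcos : 0 < Real.cos u := Real.cos_pos_of_mem_Ioo ⟨hlo, (hI hu).2⟩
  have hφ1 : ∀ v ∈ Set.Ioo a b, HasDerivAt φ (deriv φ v) v := fun v hv =>
    ((hφ.differentiableOn (by norm_num)).differentiableAt
      (isOpen_Ioo.mem_nhds hv)).hasDerivAt
  have hφ2 : HasDerivAt (deriv φ) (deriv (deriv φ) u) u :=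
    (((hφ.deriv_of_isOpen (m := 1) isOpen_Ioo (by norm_num)).differentiableOn
      (by norm_num)).differentiableAt (isOpen_Ioo.mem_nhds hu)).hasDerivAt
  have hψ1 : ∀ t, Real.arctan t ∈ Set.Ioo a b →
      HasDerivAt (fun t : ℝ => φ (Real.arctan t))
        (deriv φ (Real.arctan t) * (1 / (1 + t ^ 2))) t := fun t ht =>
    (hφ1 _ ht).comp t (Real.hasDerivAt_arctan t)
  have hev : deriv (fun t : ℝ => φ (Real.arctan t)) =ᶠ[nhds (Real.tan u)]
      fun t => deriv φ (Real.arctan t) * (1 / (1 + t ^ 2)) := by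
    have hmem : ∀ᶠ t in nhds (Real.tan u), Real.arctan t ∈ Set.Ioo a b :=
      Real.continuous_arctan.continuousAt.eventually
        (isOpen_Ioo.mem_nhds (by rwa [hu_arctan]))
    filter_upwards [hmem] with t ht using (hψ1 t ht).deriv
  have hpos : (1 + Real.tan u ^ 2) ≠ 0 := by positivity
  have hψ2 : HasDerivAt (fun t : ℝ => deriv φ (Real.arctan t) * (1 / (1 + t ^ 2)))
      (deriv (deriv φ) u * (1 / (1 + Real.tan u ^ 2)) * (1 / (1 + Real.tan u ^ 2))
        + deriv φ u * (-(2 * Real.tan u) / (1 + Real.tan u ^ 2) ^ 2)) (Real.tan u) := by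
    have h1 : HasDerivAt (fun t : ℝ => deriv φ (Real.arctan t))
        (deriv (deriv φ) u * (1 / (1 + Real.tan u ^ 2))) (Real.tan u) :=
      HasDerivAt.comp (h₂ := deriv φ) (Real.tan u) (by rwa [hu_arctan])
        (Real.hasDerivAt_arctan _)
    have h2 : HasDerivAt (fun t : ℝ => 1 / (1 + t ^ 2))
        (-(2 * Real.tan u) / (1 + Real.tan u ^ 2) ^ 2) (Real.tan u) := by
      simpa [one_div] using (((hasDerivAt_id (Real.tan u)).pow 2).const_add 1).fun_inv hpos
    simpa only [hu_arctan] using h1.fun_mul h2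
  rw [hev.deriv_eq, hψ2.deriv, hev.eq_of_nhds, hu_arctan]
  have hsin : Real.sin u = Real.tan u * Real.cos u := (Real.tan_mul_cos hcos.ne').symm
  have hden := hne u hu
  have h := hode u hu
  rw [hsin] at h hden
  generalize Real.tan u = τ at *
  have hd : c₂ - c₁ * τ ≠ 0 := fun h0 => hden (by linear_combination Real.cos u * h0)
  have hα : (-2 * c₁ * Real.cos u - 2 * c₂ * (τ * Real.cos u))
      / (-c₁ * (τ * Real.cos u) + c₂ * Real.cos u)
      = (-2 * c₁ - 2 * c₂ * τ) / (c₂ - c₁ * τ) := by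
    rw [← mul_div_mul_right _ (c₂ - c₁ * τ) hcos.ne']
    ring_nf
  have hβ : (-c₄ * (τ * Real.cos u) + c₅ * Real.cos u)
      / (-c₁ * (τ * Real.cos u) + c₂ * Real.cos u)
      = (-c₄ * τ + c₅) / (c₂ - c₁ * τ) := by
    rw [← mul_div_mul_right _ (c₂ - c₁ * τ) hcos.ne']
    ring_nf
  rw [hα, hβ] at h
  have hd1 : c₁ * τ - c₂ = -(c₂ - c₁ * τ) := by ring
  have hd2 : -c₁ * τ + c₂ = c₂ - c₁ * τ := by ring
  have hφ'' : deriv (deriv φ) u = (-c₄ * τ + c₅) / (c₂ - c₁ * τ) * φ u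
      - (-2 * c₁ - 2 * c₂ * τ) / (c₂ - c₁ * τ) * deriv φ u := by linear_combination h
  rw [hd1, hd2, hφ'']
  obtain ⟨d, rfl⟩ : ∃ d, c₂ = d + c₁ * τ := ⟨c₂ - c₁ * τ, by ring⟩
  rw [add_sub_cancel_right] at hd ⊢
  field_simp
  ring
end

section
/- For every smooth function f : ℝ → ℝ with compact support contained in (0,∞) and every x > 0, the Carleman operator Γ with kernel 1/(x+y) commutes with L = −(d/dx)(x²·d/dx): that is, −(d/dx)( x²·(d/dx) ∫₀^∞ f(y)/(x+y) dy ) = ∫₀^∞ ( −(y² f'(y))' )/(x+y) dy. -/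
open MeasureTheory

open Filter Topology

/-- The generalized Stieltjes integrand `g y / (x + y) ^ n` is integrable on `(0, ∞)` when `x > 0`
and `g` is integrable. -/
theorem integrableOn_div_add_pow {g : ℝ → ℝ} (hg : Integrable g) (n : ℕ) {x : ℝ} (hx : 0 < x) :
    IntegrableOn (fun y => g y / (x + y) ^ n) (Set.Ioi 0) := by
  refine Integrable.mono' (g := fun y => |g y| / x ^ n) (hg.abs.div_const _).integrableOn
    (hg.aestronglyMeasurable.restrict.div₀ (by fun_prop)) ?_
  filter_upwards [ae_restrict_mem measurableSet_Ioi] with y hy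
  have hy : 0 < y := hy
  rw [norm_div, norm_pow, Real.norm_eq_abs, Real.norm_eq_abs, abs_of_pos (by positivity : 0 < x + y)]
  gcongr
  linarith

/-- Differentiation under the integral sign for the generalized Stieltjes transform. -/
theorem hasDerivAt_integral_div_add_pow {g : ℝ → ℝ} (hg : Integrable g) (n : ℕ) {x : ℝ}
    (hx : 0 < x) :
    HasDerivAt (fun x : ℝ => ∫ y in Set.Ioi (0 : ℝ), g y / (x + y) ^ n)
      (-n * ∫ y in Set.Ioi (0 : ℝ), g y / (x + y) ^ (n + 1)) x := by
  rw [← integral_const_mul]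
  have hpos : ∀ z ∈ Set.Ioi (x / 2), 0 < z := fun z hz => (half_pos hx).trans hz
  refine (hasDerivAt_integral_of_dominated_loc_of_deriv_le (s := Set.Ioi (x / 2))
    (F := fun z y => g y / (z + y) ^ n)
    (F' := fun z y => -n * (g y / (z + y) ^ (n + 1)))
    (bound := fun y => n * (|g y| / (x / 2) ^ (n + 1)))
    (Ioi_mem_nhds (half_lt_self hx)) ?_ (integrableOn_div_add_pow hg n hx)
    ((integrableOn_div_add_pow hg (n + 1) hx).const_mul _).aestronglyMeasurable ?_
    ((hg.abs.div_const _).const_mul _).integrableOn ?_).2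
  · filter_upwards [Ioi_mem_nhds hx] with z hz
    exact (integrableOn_div_add_pow hg n hz).aestronglyMeasurable
  · filter_upwards [ae_restrict_mem measurableSet_Ioi] with y hy z hz
    have hy : 0 < y := hy
    have hz0 := hpos z hz
    have hz : x / 2 < z := hz
    rw [norm_mul, norm_div, norm_pow, norm_neg, Real.norm_natCast, Real.norm_eq_abs,
      Real.norm_eq_abs, abs_of_pos (by positivity : 0 < z + y)]
    gcongr
    linarith
  · filter_upwards [ae_restrict_mem measurableSet_Ioi] with y hy z hz
    have hy : 0 < y := hy
    have hzy : z + y ≠ 0 := (add_pos (hpos z hz) hy).ne'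
    have h := (hasDerivAt_const z (g y)).div (((hasDerivAt_id z).add_const y).pow n)
      (pow_ne_zero n hzy)
    refine h.congr_deriv ?_
    rcases n with _ | n
    · simp
    · simp only [id, Pi.pow_apply, Nat.add_sub_cancel]
      field_simp
      ring

/-- Integrating by parts twice moves `L = -(d/dy) (y² d/dy)` from `f` to the kernel
`1 / (x + y)`. -/
theorem integral_neg_deriv_sq_mul_deriv_div_add {f : ℝ → ℝ} (hf : ContDiff ℝ 2 f)
    (hfc : HasCompactSupport f) {x : ℝ} (hx : 0 < x) :
    ∫ y in Set.Ioi (0 : ℝ), -deriv (fun y : ℝ => y ^ 2 * deriv f y) y / (x + y)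
      = ∫ y in Set.Ioi (0 : ℝ), 2 * x * y * f y / (x + y) ^ 3 := by
  have hf' : ContDiff ℝ 1 (deriv f) := hf.deriv'
  have hp : ContDiff ℝ 1 (fun y : ℝ => y ^ 2 * deriv f y) := by fun_prop
  have hpc : HasCompactSupport (fun y : ℝ => y ^ 2 * deriv f y) := hfc.deriv.mul_left
  have hi₁ : IntegrableOn (fun y => -deriv (fun y : ℝ => y ^ 2 * deriv f y) y / (x + y))
      (Set.Ioi 0) := by
    simpa using integrableOn_div_add_pow
      ((hp.continuous_deriv le_rfl).integrable_of_hasCompactSupport hpc.deriv).neg 1 hx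
  have hi₂ : IntegrableOn (fun y => 2 * x * y * f y / (x + y) ^ 3) (Set.Ioi 0) :=
    integrableOn_div_add_pow (Continuous.integrable_of_hasCompactSupport
      (by have := hf.continuous; fun_prop) hfc.mul_left) 3 hx
  rw [← sub_eq_zero, ← integral_sub hi₁ hi₂]
  have hderiv : ∀ y ∈ Set.Ici (0 : ℝ), HasDerivAt
      (fun y => -(y ^ 2 * deriv f y) / (x + y) - y ^ 2 * f y / (x + y) ^ 2)
      (-deriv (fun y : ℝ => y ^ 2 * deriv f y) y / (x + y) - 2 * x * y * f y / (x + y) ^ 3) y := by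
    intro y hy
    have hy : 0 ≤ y := hy
    have hxy : x + y ≠ 0 := by positivity
    have hq := (hasDerivAt_id y).const_add x
    have hd := ((hp.differentiable one_ne_zero y).hasDerivAt.neg.div hq hxy).sub
      ((((hasDerivAt_id y).pow 2).mul (hf.differentiable two_ne_zero y).hasDerivAt).div
        (hq.pow 2) (pow_ne_zero 2 hxy))
    refine hd.congr_deriv ?_
    simp only [id, Pi.pow_apply, Pi.mul_apply, Pi.neg_apply]
    field_simp
    ring
  have hlim : Tendsto
      (fun y => -(y ^ 2 * deriv f y) / (x + y) - y ^ 2 * f y / (x + y) ^ 2) atTop (𝓝 0) := by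
    have h₀ := hasCompactSupport_iff_eventuallyEq.1 hfc
    have h₁ := hasCompactSupport_iff_eventuallyEq.1 hfc.deriv
    rw [coclosedCompact_eq_cocompact] at h₀ h₁
    refine tendsto_const_nhds.congr' ?_
    filter_upwards [h₀.filter_mono atTop_le_cocompact,
      h₁.filter_mono atTop_le_cocompact] with y hy₀ hy₁
    simp [hy₀, hy₁]
  rw [integral_Ioi_of_hasDerivAt_of_tendsto' hderiv (hi₁.sub hi₂) hlim]
  simp

/-- Case Q(iii): the Carleman operator `(Γ f)(x) = ∫₀^∞ f(y)/(x+y) dy` commutes with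
the differential operator `L = -(d/dx)(x² d/dx)` on smooth functions compactly
supported in `(0,∞)`. -/
theorem stmt_11 (f : ℝ → ℝ) (hf : ContDiff ℝ (⊤ : ℕ∞) f) (hfc : HasCompactSupport f)
    (hfs : tsupport f ⊆ Set.Ioi 0) (x : ℝ) (hx : 0 < x) :
    -(deriv (fun x : ℝ => x ^ 2 *
        deriv (fun x : ℝ => ∫ y in Set.Ioi (0:ℝ), f y / (x + y)) x) x)
    = ∫ y in Set.Ioi (0:ℝ), (-(deriv (fun y : ℝ => y ^ 2 * deriv f y) y)) / (x + y) := by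
  have hfi : Integrable f := hf.continuous.integrable_of_hasCompactSupport hfc
  rw [integral_neg_deriv_sq_mul_deriv_div_add (contDiff_infty.1 hf 2) hfc hx]
  have hev : (fun x : ℝ => x ^ 2 * deriv (fun x : ℝ => ∫ y in Set.Ioi (0:ℝ), f y / (x + y)) x)
      =ᶠ[𝓝 x] fun x => -(x ^ 2 * ∫ y in Set.Ioi (0:ℝ), f y / (x + y) ^ 2) := by
    filter_upwards [Ioi_mem_nhds hx] with z hz
    have h := (hasDerivAt_integral_div_add_pow hfi 1 hz).deriv
    simp only [pow_one] at h
    rw [h]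
    norm_num
  have hd := ((hasDerivAt_pow 2 x).mul (hasDerivAt_integral_div_add_pow hfi 2 hx)).neg
  rw [hev.deriv_eq]
  refine (congrArg Neg.neg hd.deriv).trans ?_
  have h₂ := integrableOn_div_add_pow hfi 2 hx
  have h₃ := integrableOn_div_add_pow hfi 3 hx
  have hsplit : ∫ y in Set.Ioi (0 : ℝ), 2 * x * y * f y / (x + y) ^ 3
      = ∫ y in Set.Ioi (0 : ℝ), (2 * x * (f y / (x + y) ^ 2) - 2 * x ^ 2 * (f y / (x + y) ^ 3)) := by
    refine setIntegral_congr_fun measurableSet_Ioi fun y hy => ?_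
    have hy : 0 < y := hy
    have hxy : x + y ≠ 0 := by positivity
    field_simp
    ring
  rw [hsplit, integral_sub (h₂.const_mul _) (h₃.const_mul _), integral_const_mul,
    integral_const_mul]
  norm_num
  ring
end

section
/- Define f(x) = e^{−x} and g(x) = e^{−x}·∫₀^∞ e^{−2t}/(x+t) dt for x > 0, and φ₊(u) = e^{−u}/u for u > 0. Then for all x, y > 0 with x ≠ y, (f(x)·g(y) − f(y)·g(x))/(x − y) = ∫₀^∞ φ₊(x+t)·φ₊(y+t) dt = ∫₀^∞ e^{−(x+t)}e^{−(y+t)}/((x+t)(y+t)) dt. -/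
open MeasureTheory

theorem integrableOn_exp_neg_two_mul_div_add {a : ℝ} (ha : 0 < a) :
    IntegrableOn (fun t : ℝ => Real.exp (-2 * t) / (a + t)) (Set.Ioi 0) := by
  have hexp : IntegrableOn (fun t : ℝ => Real.exp (-2 * t)) (Set.Ioi 0) :=
    exp_neg_integrableOn_Ioi 0 two_pos
  refine (hexp.div_const a).mono' ?_ ?_
  · exact (Measurable.div (by fun_prop) (by fun_prop)).aestronglyMeasurable
  · filter_upwards [ae_restrict_mem measurableSet_Ioi] with t ht
    have ht : 0 < t := ht
    rw [Real.norm_of_nonneg (by positivity)]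
    gcongr
    linarith

/-- The factorization identity (3.13) of case Q(vii): with `f x = e^{-x}`,
`g x = e^{-x} ∫₀^∞ e^{-2t}/(x+t) dt` and `φ₊ u = e^{-u}/u`, one has
`(f x · g y - f y · g x)/(x - y) = ∫₀^∞ φ₊(x+t) φ₊(y+t) dt`. -/
theorem stmt_12 (x y : ℝ) (hx : 0 < x) (hy : 0 < y) (hxy : x ≠ y) :
    (Real.exp (-x) * (Real.exp (-y) * ∫ t in Set.Ioi (0:ℝ), Real.exp (-2*t) / (y + t))
        - Real.exp (-y) * (Real.exp (-x) * ∫ t in Set.Ioi (0:ℝ), Real.exp (-2*t) / (x + t)))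
      / (x - y)
    = (∫ t in Set.Ioi (0:ℝ), (Real.exp (-(x+t)) / (x+t)) * (Real.exp (-(y+t)) / (y+t))) ∧
    (∫ t in Set.Ioi (0:ℝ), (Real.exp (-(x+t)) / (x+t)) * (Real.exp (-(y+t)) / (y+t)))
    = ∫ t in Set.Ioi (0:ℝ), Real.exp (-(x+t)) * Real.exp (-(y+t)) / ((x+t) * (y+t)) := by
  refine ⟨?_, by simp_rw [div_mul_div_comm]⟩
  rw [div_eq_iff (sub_ne_zero.mpr hxy), mul_left_comm (Real.exp (-y)), ← mul_sub, ← mul_sub,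
    ← integral_sub (integrableOn_exp_neg_two_mul_div_add hy)
      (integrableOn_exp_neg_two_mul_div_add hx),
    ← integral_const_mul, ← integral_const_mul, ← integral_mul_const]
  refine setIntegral_congr_fun measurableSet_Ioi fun t ht => ?_
  have ht : 0 < t := ht
  have hxt : x + t ≠ 0 := by positivity
  have hyt : y + t ≠ 0 := by positivity
  have hexp : Real.exp (-(x + t)) * Real.exp (-(y + t))
      = Real.exp (-x) * Real.exp (-y) * Real.exp (-2 * t) := by
    simp only [← Real.exp_add]
    ring_nf
  rw [div_mul_div_comm, hexp]
  field_simp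
  ring
end
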